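/- arXiv:2310.03234 — 2 statements merged into one kernel-verified Lean document; each statement's English description precedes it below -/
import Mathlib

section
/- Let S be a finite set of n items. For each i ∈ S let f_i : ℝ^{d₁} → ℝ be ρ_f-weakly-convex, C_f-Lipschitz continuous and non-decreasing, and let g_i : ℝ^d → ℝ^{d₁} be ρ_g-weakly-convex and C_g-Lipschitz continuous. Then the finite-sum coupled compositional objective F(w) = (1/n)·Σ_{i∈S} f_i(g_i(w)) is ρ_F-weakly-convex with ρ_F = √d₁·ρ_g·C_f + ρ_f·C_g². -/
noncomputable section

/-- A real-valued function on a real inner product space is `ρ`-weakly convex if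
adding `ρ/2 ‖·‖²` makes it convex. -/
def WeaklyConvex {E : Type*} [NormedAddCommGroup E] [InnerProductSpace ℝ E]
    (ρ : ℝ) (f : E → ℝ) : Prop :=
  ConvexOn ℝ Set.univ fun x => f x + ρ / 2 * ‖x‖ ^ 2

/-- A vector-valued function is `ρ`-weakly convex if each component is. -/
def WeaklyConvexVec {E : Type*} [NormedAddCommGroup E] [InnerProductSpace ℝ E]
    {m : ℕ} (ρ : ℝ) (g : E → EuclideanSpace ℝ (Fin m)) : Prop :=
  ∀ j : Fin m, WeaklyConvex ρ fun x => g x j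

/-- `f` is `C`-Lipschitz continuous. -/
def LipschitzC {E F : Type*} [NormedAddCommGroup E] [NormedAddCommGroup F]
    (C : ℝ) (f : E → F) : Prop :=
  ∀ x y, ‖f x - f y‖ ≤ C * ‖x - y‖

/-- A scalar function on `ℝ^m` is non-decreasing with respect to each coordinate
of the input. -/
def CoordNonDecreasing {m : ℕ} (f : EuclideanSpace ℝ (Fin m) → ℝ) : Prop :=
  ∀ (k : Fin m) (x : EuclideanSpace ℝ (Fin m)),
    Monotone fun t : ℝ => f (x + t • EuclideanSpace.single k (1 : ℝ))

/-- A scalar function on `ℝ^m` is monotone: with respect to each coordinate of the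
input it is either non-decreasing or non-increasing. -/
def CoordMonotone {m : ℕ} (f : EuclideanSpace ℝ (Fin m) → ℝ) : Prop :=
  ∀ k : Fin m,
    (∀ x, Monotone fun t : ℝ => f (x + t • EuclideanSpace.single k (1 : ℝ))) ∨
    (∀ x, Antitone fun t : ℝ => f (x + t • EuclideanSpace.single k (1 : ℝ)))

/-- A vector-valued function is non-decreasing if each component is non-decreasing
with respect to each coordinate of the input. -/
def CoordNonDecreasingVec {m₁ m₂ : ℕ}
    (g : EuclideanSpace ℝ (Fin m₁) → EuclideanSpace ℝ (Fin m₂)) : Prop :=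
  ∀ j : Fin m₂, CoordNonDecreasing fun x => g x j

/-- A vector-valued function is monotone if each component is monotone. -/
def CoordMonotoneVec {m₁ m₂ : ℕ}
    (g : EuclideanSpace ℝ (Fin m₁) → EuclideanSpace ℝ (Fin m₂)) : Prop :=
  ∀ j : Fin m₂, CoordMonotone fun x => g x j

/-- `f` is `L`-smooth: differentiable with `L`-Lipschitz derivative. -/
def SmoothL {E F : Type*} [NormedAddCommGroup E] [NormedSpace ℝ E]
    [NormedAddCommGroup F] [NormedSpace ℝ F] (L : ℝ) (f : E → F) : Prop :=
  Differentiable ℝ f ∧ ∀ x y, ‖fderiv ℝ f x - fderiv ℝ f y‖ ≤ L * ‖x - y‖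

/-- `v` is a general subgradient of `f` at `x`:
`f y ≥ f x + ⟪v, y - x⟫ + o(‖y - x‖)` as `y → x`. -/
def IsSubgradient {E : Type*} [NormedAddCommGroup E] [InnerProductSpace ℝ E]
    (f : E → ℝ) (x v : E) : Prop :=
  ∀ ε > 0, ∃ δ > 0, ∀ y, ‖y - x‖ < δ →
    f x + @inner ℝ _ _ v (y - x) - ε * ‖y - x‖ ≤ f y

theorem norm_sq_convex_combination {E : Type*} [NormedAddCommGroup E] [InnerProductSpace ℝ E]
    {a b : ℝ} (hab : a + b = 1) (x y : E) :
    ‖a • x + b • y‖ ^ 2 = a * ‖x‖ ^ 2 + b * ‖y‖ ^ 2 - a * b * ‖x - y‖ ^ 2 := by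
  rw [norm_add_sq_real, norm_sub_sq_real, norm_smul, norm_smul, mul_pow, mul_pow,
    Real.norm_eq_abs, Real.norm_eq_abs, sq_abs, sq_abs, real_inner_smul_left,
    real_inner_smul_right]
  obtain rfl : b = 1 - a := by linarith
  ring

theorem weaklyConvex_iff {E : Type*} [NormedAddCommGroup E] [InnerProductSpace ℝ E]
    {ρ : ℝ} {f : E → ℝ} :
    WeaklyConvex ρ f ↔ ∀ x y : E, ∀ a b : ℝ, 0 ≤ a → 0 ≤ b → a + b = 1 →
      f (a • x + b • y) ≤ a * f x + b * f y + ρ / 2 * (a * b * ‖x - y‖ ^ 2) := by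
  unfold WeaklyConvex
  constructor
  · intro h x y a b ha hb hab
    have := h.2 (Set.mem_univ x) (Set.mem_univ y) ha hb hab
    simp only [smul_eq_mul, norm_sq_convex_combination hab] at this
    linarith
  · refine fun h => ⟨convex_univ, fun x _ y _ a b ha hb hab => ?_⟩
    have := h x y a b ha hb hab
    simp only [smul_eq_mul, norm_sq_convex_combination hab]
    linarith

theorem WeaklyConvex.const_mul_sum {E ι : Type*} [NormedAddCommGroup E] [InnerProductSpace ℝ E]
    {ρ c : ℝ} {f : ι → E → ℝ} (s : Finset ι) (hc : 0 ≤ c)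
    (hf : ∀ i ∈ s, WeaklyConvex ρ (f i)) :
    WeaklyConvex (c * s.card * ρ) fun x => c * ∑ i ∈ s, f i x := by
  rw [weaklyConvex_iff]
  intro x y a b ha hb hab
  have h := mul_le_mul_of_nonneg_left
    (Finset.sum_le_sum fun i hi => weaklyConvex_iff.1 (hf i hi) x y a b ha hb hab) hc
  simp only [Finset.sum_add_distrib, ← Finset.mul_sum, Finset.sum_const, nsmul_eq_mul] at h
  linarith

theorem CoordNonDecreasing.le_of_forall_le {m : ℕ} {f : EuclideanSpace ℝ (Fin m) → ℝ}
    (hf : CoordNonDecreasing f) {x y : EuclideanSpace ℝ (Fin m)} (hxy : ∀ k, x k ≤ y k) :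
    f x ≤ f y := by
  have key (s : Finset (Fin m)) :
      f x ≤ f (x + ∑ k ∈ s, (y k - x k) • EuclideanSpace.single k (1 : ℝ)) := by
    induction s using Finset.induction_on with
    | empty => simp
    | insert k s hk ih =>
      rw [Finset.sum_insert hk, add_comm (_ • _), ← add_assoc]
      refine ih.trans ?_
      simpa using hf k (x + ∑ k ∈ s, (y k - x k) • EuclideanSpace.single k (1 : ℝ))
        (sub_nonneg.2 (hxy k))
  convert key Finset.univ
  ext j
  simp [Pi.single_apply]

theorem WeaklyConvex.comp_of_coordNonDecreasing {E : Type*} [NormedAddCommGroup E]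
    [InnerProductSpace ℝ E] {m : ℕ} {ρf ρg Cf Cg : ℝ}
    {f : EuclideanSpace ℝ (Fin m) → ℝ} {g : E → EuclideanSpace ℝ (Fin m)}
    (hρf : 0 ≤ ρf) (hρg : 0 ≤ ρg) (hf : WeaklyConvex ρf f) (hflip : LipschitzC Cf f)
    (hfmono : CoordNonDecreasing f) (hg : WeaklyConvexVec ρg g) (hglip : LipschitzC Cg g) :
    WeaklyConvex (√m * ρg * Cf + ρf * Cg ^ 2) fun w => f (g w) := by
  rw [weaklyConvex_iff]
  intro x y a b ha hb hab
  set c : ℝ := ρg / 2 * (a * b * ‖x - y‖ ^ 2) with hc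
  have hc0 : 0 ≤ c := by positivity
  set p : EuclideanSpace ℝ (Fin m) := a • g x + b • g y with hp
  set u : EuclideanSpace ℝ (Fin m) := WithLp.toLp 2 fun _ => c with hu
  have hnorm : ‖u‖ = √m * c := by
    simp [hu, EuclideanSpace.norm_eq, Real.sqrt_sq hc0]
  have hmono : f (g (a • x + b • y)) ≤ f (p + u) :=
    hfmono.le_of_forall_le fun k => by
      simpa [hp, hu] using weaklyConvex_iff.1 (hg k) x y a b ha hb hab
  have hlip : f (p + u) - f p ≤ Cf * (√m * c) := by
    simpa [hnorm] using (le_abs_self _).trans (hflip (p + u) p)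
  have hconv := weaklyConvex_iff.1 hf (g x) (g y) a b ha hb hab
  have hsq : ρf / 2 * (a * b * ‖g x - g y‖ ^ 2) ≤
      ρf / 2 * (a * b * (Cg * ‖x - y‖) ^ 2) := by
    gcongr
    exact hglip x y
  have hsplit : (√m * ρg * Cf + ρf * Cg ^ 2) / 2 * (a * b * ‖x - y‖ ^ 2) =
      Cf * (√m * c) + ρf / 2 * (a * b * (Cg * ‖x - y‖) ^ 2) := by
    rw [hc]
    ring
  linarith

/-- Proposition 1. Under Assumption 1, the FCCO objective
`F(w) = (1/n) Σ_{i∈S} f_i(g_i(w))` is `ρ_F`-weakly convex with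
`ρ_F = √d₁ ρ_g C_f + ρ_f C_g²`. -/
theorem fcco_objective_weakly_convex
    (d d₁ n : ℕ) (hn : 0 < n)
    (ρf ρg Cf Cg : ℝ) (hρf : 0 ≤ ρf) (hρg : 0 ≤ ρg) (hCf : 0 ≤ Cf) (hCg : 0 ≤ Cg)
    (f : Fin n → EuclideanSpace ℝ (Fin d₁) → ℝ)
    (g : Fin n → EuclideanSpace ℝ (Fin d) → EuclideanSpace ℝ (Fin d₁))
    (hfwc : ∀ i, WeaklyConvex ρf (f i))
    (hflip : ∀ i, LipschitzC Cf (f i))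
    (hfmono : ∀ i, CoordNonDecreasing (f i))
    (hgwc : ∀ i, WeaklyConvexVec ρg (g i))
    (hglip : ∀ i, LipschitzC Cg (g i)) :
    WeaklyConvex (Real.sqrt d₁ * ρg * Cf + ρf * Cg ^ 2)
      (fun w => (n : ℝ)⁻¹ * ∑ i, f i (g i w)) := by
  have hn' : (n : ℝ) ≠ 0 := by positivity
  simpa [inv_mul_cancel₀ hn'] using
    WeaklyConvex.const_mul_sum (c := (n : ℝ)⁻¹) Finset.univ (by positivity) fun i _ =>
      (hfwc i).comp_of_coordNonDecreasing hρf hρg (hflip i) (hfmono i) (hgwc i) (hglip i)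
end
end

section
/- Let f : ℝ^{d₁} → ℝ be ρ_f-weakly-convex, C_f-Lipschitz continuous and non-decreasing, and let g : ℝ^d → ℝ^{d₁} be ρ_g-weakly-convex and C_g-Lipschitz continuous. Then for all w, ŵ ∈ ℝ^d, all u ∈ ℝ^{d₁}, every subgradient v ∈ ∂f(u), and every subgradient matrix G ∈ ℝ^{d×d₁} of g at w: ⟨G·v, ŵ − w⟩ ≤ f(g(ŵ)) − f(u) − ⟨v, g(w) − u⟩ + (√d₁·ρ_g·C_f/2 + ρ_f·C_g²)·‖ŵ − w‖² + ρ_f·‖g(w) − u‖². -/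
noncomputable section

/-- A subgradient pairs with a direction to at most any linear upper bound on the growth
along that direction. -/
theorem IsSubgradient.inner_le_of_forall_le {E : Type*} [NormedAddCommGroup E]
    [InnerProductSpace ℝ E] {f : E → ℝ} {x v : E} (hv : IsSubgradient f x v) {z : E} {a : ℝ}
    (h : ∀ t : ℝ, 0 < t → t ≤ 1 → f (x + t • z) ≤ f x + t * a) : inner ℝ v z ≤ a := by
  refine le_of_forall_pos_le_add fun ε hε => ?_
  have hz : 0 < ‖z‖ + 1 := by positivity
  obtain ⟨δ, hδ, hsub⟩ := hv (ε / (‖z‖ + 1)) (by positivity)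
  obtain ⟨t, ht, ht1, htδ⟩ : ∃ t : ℝ, 0 < t ∧ t ≤ 1 ∧ t * (‖z‖ + 1) ≤ δ :=
    ⟨min 1 (δ / (‖z‖ + 1)), lt_min one_pos (by positivity), min_le_left _ _,
      (le_div_iff₀ hz).1 (min_le_right _ _)⟩
  have hnorm : ‖x + t • z - x‖ = t * ‖z‖ := by
    rw [add_sub_cancel_left, norm_smul, Real.norm_of_nonneg ht.le]
  have key := (hsub (x + t • z) (by rw [hnorm]; linarith)).trans (h t ht ht1)
  rw [hnorm, add_sub_cancel_left, inner_smul_right] at key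
  have hε' : ε / (‖z‖ + 1) * ‖z‖ ≤ ε := by
    rw [div_mul_eq_mul_div, div_le_iff₀ hz]
    linarith
  have hmul : t * inner ℝ v z ≤ t * (a + ε / (‖z‖ + 1) * ‖z‖) := by linarith
  linarith [le_of_mul_le_mul_left hmul ht]

/-- Subgradients of a weakly convex function satisfy a global quadratic lower bound. -/
theorem IsSubgradient.inner_le_of_weaklyConvex {E : Type*} [NormedAddCommGroup E]
    [InnerProductSpace ℝ E] {f : E → ℝ} {x v : E} {ρ : ℝ} (hv : IsSubgradient f x v)
    (hρ : 0 ≤ ρ) (hf : WeaklyConvex ρ f) (y : E) :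
    inner ℝ v (y - x) ≤ f y - f x + ρ / 2 * ‖y - x‖ ^ 2 := by
  refine hv.inner_le_of_forall_le fun t ht ht1 => ?_
  have hconv := hf.2 (Set.mem_univ x) (Set.mem_univ y) (sub_nonneg.2 ht1) ht.le (by ring)
  have hpt : (1 - t) • x + t • y = x + t • (y - x) := by module
  simp only [hpt, smul_eq_mul] at hconv
  have hx : ‖x + t • (y - x)‖ ^ 2 =
      ‖x‖ ^ 2 + 2 * (t * inner ℝ x (y - x)) + t ^ 2 * ‖y - x‖ ^ 2 := by
    rw [norm_add_sq_real, inner_smul_right, norm_smul, mul_pow, Real.norm_eq_abs, sq_abs]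
  have hy : ‖y‖ ^ 2 = ‖x‖ ^ 2 + 2 * inner ℝ x (y - x) + ‖y - x‖ ^ 2 := by
    rw [← norm_add_sq_real, add_sub_cancel]
  rw [hx, hy] at hconv
  have : 0 ≤ ρ / 2 * (t ^ 2 * ‖y - x‖ ^ 2) := by positivity
  linarith

/-- Subgradients of a `C`-Lipschitz function have norm at most `C`. -/
theorem IsSubgradient.norm_le_of_lipschitzC {E : Type*} [NormedAddCommGroup E]
    [InnerProductSpace ℝ E] {f : E → ℝ} {x v : E} {C : ℝ} (hv : IsSubgradient f x v)
    (hC : 0 ≤ C) (hf : LipschitzC C f) : ‖v‖ ≤ C := by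
  have h : inner ℝ v v ≤ C * ‖v‖ := hv.inner_le_of_forall_le fun t ht _ => by
    have hlip := (le_abs_self _).trans (hf (x + t • v) x)
    rw [add_sub_cancel_left, norm_smul, Real.norm_of_nonneg ht.le] at hlip
    linarith
  rw [real_inner_self_eq_norm_mul_norm] at h
  rcases (norm_nonneg v).eq_or_lt with h0 | h0
  · rwa [← h0]
  · exact le_of_mul_le_mul_right h h0

/-- Subgradients of a coordinatewise non-decreasing function are nonnegative. -/
theorem IsSubgradient.nonneg_of_coordNonDecreasing {m : ℕ} {f : EuclideanSpace ℝ (Fin m) → ℝ}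
    {x v : EuclideanSpace ℝ (Fin m)} (hv : IsSubgradient f x v) (hf : CoordNonDecreasing f)
    (j : Fin m) : 0 ≤ v j := by
  have h : inner ℝ v (-EuclideanSpace.single j (1 : ℝ)) ≤ 0 :=
    hv.inner_le_of_forall_le fun t ht _ => by
      have := hf j x (neg_nonpos.2 ht.le)
      simpa using this
  simpa [inner_neg_right, EuclideanSpace.inner_single_right] using h

/-- The sum of the coordinates is at most `√m` times the Euclidean norm. -/
theorem EuclideanSpace.sum_le_sqrt_mul_norm {m : ℕ} (v : EuclideanSpace ℝ (Fin m)) :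
    ∑ j, v j ≤ √m * ‖v‖ := by
  refine (Real.le_sqrt_of_sq_le (y := m * ‖v‖ ^ 2) ?_).trans_eq ?_
  · simpa [EuclideanSpace.real_norm_sq_eq] using
      sq_sum_le_card_mul_sum_sq (s := Finset.univ) (f := fun j => v j)
  · rw [Real.sqrt_mul (Nat.cast_nonneg m), Real.sqrt_sq (norm_nonneg v)]

/-- The key inner-product inequality in the convergence analysis of
SONX: if `f` is `ρ_f`-weakly convex, `C_f`-Lipschitz and non-decreasing, and `g` is
`ρ_g`-weakly convex and `C_g`-Lipschitz, then for any points `w, ŵ, u`, any subgradient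
`v ∈ ∂f(u)` and any subgradient matrix `G` of `g` at `w`,
`⟨G v, ŵ − w⟩ ≤ f(g(ŵ)) − f(u) − ⟨v, g(w) − u⟩ + (√d₁ ρ_g C_f/2 + ρ_f C_g²)‖ŵ − w‖²
  + ρ_f ‖g(w) − u‖²`. -/
theorem sonx_key_inner_product_inequality
    (d d₁ : ℕ) (ρf ρg Cf Cg : ℝ)
    (hρf : 0 ≤ ρf) (hρg : 0 ≤ ρg) (hCf : 0 ≤ Cf) (hCg : 0 ≤ Cg)
    (f : EuclideanSpace ℝ (Fin d₁) → ℝ)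
    (g : EuclideanSpace ℝ (Fin d) → EuclideanSpace ℝ (Fin d₁))
    (hfwc : WeaklyConvex ρf f)
    (hflip : LipschitzC Cf f)
    (hfmono : CoordNonDecreasing f)
    (hgwc : WeaklyConvexVec ρg g)
    (hglip : LipschitzC Cg g)
    (w what : EuclideanSpace ℝ (Fin d)) (u v : EuclideanSpace ℝ (Fin d₁))
    (hv : IsSubgradient f u v)
    (G : Fin d₁ → EuclideanSpace ℝ (Fin d))
    (hG : ∀ j, IsSubgradient (fun x => g x j) w (G j)) :
    @inner ℝ _ _ (∑ j, v j • G j) (what - w) ≤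
      f (g what) - f u - @inner ℝ _ _ v (g w - u)
        + (Real.sqrt d₁ * ρg * Cf / 2 + ρf * Cg ^ 2) * ‖what - w‖ ^ 2
        + ρf * ‖g w - u‖ ^ 2 := by
  have hf := hv.inner_le_of_weaklyConvex hρf hfwc (g what)
  have hsplit : inner ℝ v (g what - u) = inner ℝ v (g what - g w) + inner ℝ v (g w - u) := by
    rw [← inner_add_right, sub_add_sub_cancel]
  have hquad : ‖g what - u‖ ^ 2 ≤ 2 * (Cg ^ 2 * ‖what - w‖ ^ 2) + 2 * ‖g w - u‖ ^ 2 := by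
    have htri : ‖g what - u‖ ≤ Cg * ‖what - w‖ + ‖g w - u‖ :=
      (norm_sub_le_norm_sub_add_norm_sub _ (g w) _).trans (by gcongr; exact hglip _ _)
    calc ‖g what - u‖ ^ 2 ≤ (Cg * ‖what - w‖ + ‖g w - u‖) ^ 2 := by gcongr
      _ ≤ _ := by nlinarith [sq_nonneg (Cg * ‖what - w‖ - ‖g w - u‖)]
  have hsum : ∑ j, v j ≤ √d₁ * Cf :=
    (EuclideanSpace.sum_le_sqrt_mul_norm v).trans
      (by gcongr; exact hv.norm_le_of_lipschitzC hCf hflip)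
  have hG' : inner ℝ (∑ j, v j • G j) (what - w) ≤
      inner ℝ v (g what - g w) + (∑ j, v j) * (ρg / 2 * ‖what - w‖ ^ 2) := by
    rw [sum_inner, Finset.sum_mul, PiLp.inner_apply, ← Finset.sum_add_distrib]
    refine Finset.sum_le_sum fun j _ => ?_
    have := mul_le_mul_of_nonneg_left
      ((hG j).inner_le_of_weaklyConvex hρg (hgwc j) what)
      (hv.nonneg_of_coordNonDecreasing hfmono j)
    simp only [real_inner_smul_left, RCLike.inner_apply, conj_trivial, PiLp.sub_apply]
    linarith
  have hρ := mul_le_mul_of_nonneg_left hquad (div_nonneg hρf zero_le_two)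
  have hs := mul_le_mul_of_nonneg_right hsum
    (show 0 ≤ ρg / 2 * ‖what - w‖ ^ 2 by positivity)
  linarith
end
end
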